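/- Corollary 3.3 (iteration-computable bound under monotone residuals). Let n, k be positive integers, A ∈ ℝ^{n×n}, x⁰, …, x^k ∈ ℝⁿ, residual vectors r^1, …, r^k ∈ ℝⁿ, and E_1, …, E_k ∈ ℝ^{n×n}. Let R_k ∈ ℝ^{n×k} be arbitrary, let ℰ_k ∈ ℝ^{n×k} be the matrix whose i-th column is E_i A (x^i − x^{i−1}), and set R̂_k = R_k + ℰ_k. Suppose R̂_k has a QR factorization R̂_k = Q̂T̂ with Q̂ᵀQ̂ = I_k and T̂ invertible, and let ĝ ∈ ℝ^k be a least-squares solution of min_g ‖R̂_k g − r^k‖₂. Let ε > 0. Assume the residual norms decrease monotonically, i.e., ‖r^k‖₂ ≤ ‖r^i‖₂ for every i = 1, …, k. If for every i = 1, …, k the bound k · ‖T̂⁻¹‖₂ · ‖E_i‖₂ · ‖r^i‖₂ · ‖x^i − x^{i−1}‖₂ ≤ ε holds, then ‖ℰ_k ĝ‖₂ ≤ ε ‖A‖₂. -/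

import Mathlib

open Matrix

noncomputable def vnorm {n : ℕ} (v : Fin n → ℝ) : ℝ :=
  ‖(WithLp.equiv 2 (Fin n → ℝ)).symm v‖

noncomputable def mnorm {m n : ℕ} (M : Matrix (Fin m) (Fin n) ℝ) : ℝ :=
  ‖LinearMap.toContinuousLinearMap (Matrix.toEuclideanLin M)‖

def IsLSSol {n k : ℕ} (M : Matrix (Fin n) (Fin k) ℝ) (r : Fin n → ℝ)
    (g : Fin k → ℝ) : Prop :=
  ∀ h : Fin k → ℝ, vnorm (M.mulVec g - r) ≤ vnorm (M.mulVec h - r)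

theorem vnorm_nonneg {n : ℕ} (v : Fin n → ℝ) : 0 ≤ vnorm v :=
  norm_nonneg _

theorem mnorm_nonneg {m n : ℕ} (M : Matrix (Fin m) (Fin n) ℝ) : 0 ≤ mnorm M :=
  norm_nonneg _

theorem vnorm_sq {n : ℕ} (v : Fin n → ℝ) : vnorm v ^ 2 = v ⬝ᵥ v := by
  rw [vnorm, EuclideanSpace.norm_sq_eq]
  simp [dotProduct, sq]

theorem vnorm_smul {n : ℕ} (c : ℝ) (v : Fin n → ℝ) : vnorm (c • v) = |c| * vnorm v := by
  simp [vnorm, norm_smul]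

theorem vnorm_sum_le {n : ℕ} {ι : Type*} (s : Finset ι) (f : ι → Fin n → ℝ) :
    vnorm (∑ i ∈ s, f i) ≤ ∑ i ∈ s, vnorm (f i) := by
  have h : WithLp.toLp 2 (∑ i ∈ s, f i) = ∑ i ∈ s, WithLp.toLp 2 (f i) :=
    map_sum (WithLp.linearEquiv 2 ℝ (Fin n → ℝ)).symm f s
  simpa [vnorm, h] using norm_sum_le s fun i => WithLp.toLp 2 (f i)

theorem abs_apply_le_vnorm {n : ℕ} (v : Fin n → ℝ) (i : Fin n) : |v i| ≤ vnorm v := by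
  simpa [vnorm] using PiLp.norm_apply_le (WithLp.toLp 2 v) i

theorem vnorm_mulVec_le {m n : ℕ} (M : Matrix (Fin m) (Fin n) ℝ) (v : Fin n → ℝ) :
    vnorm (M.mulVec v) ≤ mnorm M * vnorm v :=
  (LinearMap.toContinuousLinearMap (Matrix.toEuclideanLin M)).le_opNorm (WithLp.toLp 2 v)

/-- Expansion of the squared residual for a matrix with orthonormal columns. -/
theorem vnorm_mulVec_sub_sq {n k : ℕ} {Q : Matrix (Fin n) (Fin k) ℝ} (hQ : Qᵀ * Q = 1)
    (y : Fin k → ℝ) (r : Fin n → ℝ) :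
    vnorm (Q.mulVec y - r) ^ 2 = y ⬝ᵥ y - 2 * (y ⬝ᵥ Qᵀ.mulVec r) + r ⬝ᵥ r := by
  have h (v : Fin n → ℝ) : Q.mulVec y ⬝ᵥ v = y ⬝ᵥ Qᵀ.mulVec v := by
    rw [← vecMul_transpose, dotProduct_mulVec]
  rw [vnorm_sq, sub_dotProduct, dotProduct_sub, dotProduct_sub, dotProduct_comm r (Q.mulVec y),
    h, h, mulVec_mulVec, hQ, one_mulVec]
  ring

theorem vnorm_transpose_mulVec_le {n k : ℕ} {Q : Matrix (Fin n) (Fin k) ℝ} (hQ : Qᵀ * Q = 1)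
    (r : Fin n → ℝ) : vnorm (Qᵀ.mulVec r) ≤ vnorm r := by
  have h := vnorm_mulVec_sub_sq hQ (Qᵀ.mulVec r) r
  rw [← vnorm_sq, ← vnorm_sq] at h
  refine (sq_le_sq₀ (vnorm_nonneg _) (vnorm_nonneg r)).mp ?_
  nlinarith [sq_nonneg (vnorm (Q.mulVec (Qᵀ.mulVec r) - r))]

/-- A least-squares solution is obtained from a QR factorization by solving `T g = Qᵀ r`. -/
theorem IsLSSol.eq_of_qr {n k : ℕ} {Q : Matrix (Fin n) (Fin k) ℝ} {T : Matrix (Fin k) (Fin k) ℝ}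
    (hQ : Qᵀ * Q = 1) (hT : IsUnit T) {r : Fin n → ℝ} {g : Fin k → ℝ}
    (hg : IsLSSol (Q * T) r g) : g = T⁻¹.mulVec (Qᵀ.mulVec r) := by
  have hdet : IsUnit T.det := (isUnit_iff_isUnit_det T).mp hT
  set c := Qᵀ.mulVec r with hc
  have h := pow_le_pow_left₀ (vnorm_nonneg _) (hg (T⁻¹.mulVec c)) 2
  rw [← mulVec_mulVec, ← mulVec_mulVec, mulVec_mulVec c T, mul_nonsing_inv T hdet, one_mulVec,
    vnorm_mulVec_sub_sq hQ, vnorm_mulVec_sub_sq hQ, ← hc] at h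
  have hy : T.mulVec g - c = 0 := by
    rw [← dotProduct_self_eq_zero]
    refine le_antisymm ?_ ((vnorm_sq (T.mulVec g - c)).symm ▸ sq_nonneg _)
    rw [sub_dotProduct, dotProduct_sub, dotProduct_sub, dotProduct_comm c (T.mulVec g)]
    linarith
  rw [← sub_eq_zero.mp hy, mulVec_mulVec, nonsing_inv_mul T hdet, one_mulVec]

theorem IsLSSol.vnorm_le_of_qr {n k : ℕ} {Q : Matrix (Fin n) (Fin k) ℝ}
    {T : Matrix (Fin k) (Fin k) ℝ} (hQ : Qᵀ * Q = 1) (hT : IsUnit T) {r : Fin n → ℝ}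
    {g : Fin k → ℝ} (hg : IsLSSol (Q * T) r g) : vnorm g ≤ mnorm T⁻¹ * vnorm r := by
  rw [hg.eq_of_qr hQ hT]
  exact (vnorm_mulVec_le _ _).trans
    (mul_le_mul_of_nonneg_left (vnorm_transpose_mulVec_le hQ r) (mnorm_nonneg _))

/-- Corollary 3.3: iteration-computable bound under monotone residuals. -/
theorem corollary_3_3 {n k : ℕ} (hn : 0 < n) (hk : 0 < k)
    (A : Matrix (Fin n) (Fin n) ℝ) (x : ℕ → Fin n → ℝ) (r : ℕ → Fin n → ℝ)
    (E : Fin k → Matrix (Fin n) (Fin n) ℝ)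
    (Rk Ecal : Matrix (Fin n) (Fin k) ℝ)
    (hE : ∀ j : Fin k,
      (fun i => Ecal i j) = (E j).mulVec (A.mulVec (x ((j : ℕ) + 1) - x (j : ℕ))))
    (Rhat : Matrix (Fin n) (Fin k) ℝ) (hRhat : Rhat = Rk + Ecal)
    (Qhat : Matrix (Fin n) (Fin k) ℝ) (That : Matrix (Fin k) (Fin k) ℝ)
    (hQR : Rhat = Qhat * That) (hQ : Qhatᵀ * Qhat = 1) (hT : IsUnit That)
    (ghat : Fin k → ℝ) (hg : IsLSSol Rhat (r k) ghat)
    (ε : ℝ) (hε : 0 < ε)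
    (hmono : ∀ j : Fin k, vnorm (r k) ≤ vnorm (r ((j : ℕ) + 1)))
    (hbound : ∀ j : Fin k,
      (k : ℝ) * mnorm That⁻¹ * mnorm (E j) * vnorm (r ((j : ℕ) + 1)) *
        vnorm (x ((j : ℕ) + 1) - x (j : ℕ)) ≤ ε) :
    vnorm (Ecal.mulVec ghat) ≤ ε * mnorm A := by
  subst hQR
  have hk' : (0 : ℝ) < k := Nat.cast_pos.mpr hk
  have hsum : Ecal.mulVec ghat = ∑ j, ghat j • fun i => Ecal i j := by
    ext i
    simp [mulVec, dotProduct, Finset.sum_apply, mul_comm]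
  have hterm (j : Fin k) : vnorm (ghat j • fun i => Ecal i j) ≤ ε * mnorm A / k := by
    set d := x ((j : ℕ) + 1) - x (j : ℕ) with hd
    have hgj : |ghat j| ≤ mnorm That⁻¹ * vnorm (r ((j : ℕ) + 1)) :=
      (abs_apply_le_vnorm ghat j).trans ((hg.vnorm_le_of_qr hQ hT).trans
        (mul_le_mul_of_nonneg_left (hmono j) (mnorm_nonneg _)))
    have hcol : vnorm ((E j).mulVec (A.mulVec d)) ≤ mnorm (E j) * (mnorm A * vnorm d) :=
      (vnorm_mulVec_le _ _).trans
        (mul_le_mul_of_nonneg_left (vnorm_mulVec_le _ _) (mnorm_nonneg _))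
    rw [hE j, vnorm_smul, le_div_iff₀ hk']
    calc |ghat j| * vnorm ((E j).mulVec (A.mulVec d)) * k
        ≤ (mnorm That⁻¹ * vnorm (r ((j : ℕ) + 1))) * (mnorm (E j) * (mnorm A * vnorm d)) * k := by
          refine mul_le_mul_of_nonneg_right ?_ hk'.le
          exact mul_le_mul hgj hcol (vnorm_nonneg _)
            (mul_nonneg (mnorm_nonneg _) (vnorm_nonneg _))
      _ = (k * mnorm That⁻¹ * mnorm (E j) * vnorm (r ((j : ℕ) + 1)) * vnorm d) * mnorm A := by
          ring
      _ ≤ ε * mnorm A := mul_le_mul_of_nonneg_right (hbound j) (mnorm_nonneg _)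
  calc vnorm (Ecal.mulVec ghat) ≤ ∑ j : Fin k, vnorm (ghat j • fun i => Ecal i j) :=
        hsum ▸ vnorm_sum_le _ _
    _ ≤ ∑ _j : Fin k, ε * mnorm A / k := Finset.sum_le_sum fun j _ => hterm j
    _ = ε * mnorm A := by
        rw [Finset.sum_const, Finset.card_univ, Fintype.card_fin, nsmul_eq_mul]
        field_simp
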